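/- The system SMLKV^r is strongly complete with respect to the class of all MLKv^r models: every SMLKV^r-consistent set of MLKv^r formulas is satisfiable at some state of some MLKv^r model; equivalently, for any set Σ ∪ {φ} of MLKv^r formulas, if Σ semantically entails φ over MLKv^r models then φ is derivable from Σ in SMLKV^r. -/

import Mathlib

/-- A Kripke frame with binary relations `rel i` and ternary relations `relc i c`,
together with a valuation; an MLKv^r model is such a frame satisfying `IsMLKv`. -/
structure KFrame where
  S : Type
  rel : ℕ → S → S → Prop
  relc : ℕ → ℕ → S → S → S → Prop
  val : S → ℕ → Prop

/-- The three frame conditions SYM, INCL and ATEUC of MLKv^r models. -/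
def KFrame.IsMLKv (M : KFrame) : Prop :=
  (∀ i c s t u, M.relc i c s t u ↔ M.relc i c s u t) ∧
  (∀ i c s t u, M.relc i c s t u → M.rel i s t ∧ M.rel i s u) ∧
  (∀ i c s t u v, M.relc i c s t u → M.rel i s v → M.relc i c s t v ∨ M.relc i c s u v)

/-- The language MLKv^r with unary modalities `box i` (□_i) and `boxc i c` (□_i^c). -/
inductive FormM : Type
  | top : FormM
  | atom : ℕ → FormM
  | neg : FormM → FormM
  | and : FormM → FormM → FormM
  | box : ℕ → FormM → FormM
  | boxc : ℕ → ℕ → FormM → FormM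

namespace FormM
def imp (φ ψ : FormM) : FormM := neg (and φ (neg ψ))
def or (φ ψ : FormM) : FormM := neg (and (neg φ) (neg ψ))
def iff (φ ψ : FormM) : FormM := and (imp φ ψ) (imp ψ φ)
def bot : FormM := neg top
def dia (i : ℕ) (φ : FormM) : FormM := neg (box i (neg φ))
def diac (i c : ℕ) (φ : FormM) : FormM := neg (boxc i c (neg φ))
end FormM

/-- Satisfaction for MLKv^r formulas; `boxc i c φ` holds at `s` iff every pair of
`relc i c`-successors contains a `φ`-world (i.e. ¬∃ u v with `relc`, both ¬φ). -/
def satM (M : KFrame) : M.S → FormM → Prop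
  | _, FormM.top => True
  | s, FormM.atom p => M.val s p
  | s, FormM.neg φ => ¬ satM M s φ
  | s, FormM.and φ ψ => satM M s φ ∧ satM M s ψ
  | s, FormM.box i φ => ∀ t, M.rel i s t → satM M t φ
  | s, FormM.boxc i c φ => ∀ t u, M.relc i c s t u → satM M t φ ∨ satM M u φ

/-- Uniform substitution of `χ` for the atom `p`. -/
def FormM.subst (p : ℕ) (χ : FormM) : FormM → FormM
  | .top => .top
  | .atom q => if q = p then χ else .atom q
  | .neg φ => .neg (FormM.subst p χ φ)
  | .and φ ψ => .and (FormM.subst p χ φ) (FormM.subst p χ ψ)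
  | .box i φ => .box i (FormM.subst p χ φ)
  | .boxc i c φ => .boxc i c (FormM.subst p χ φ)

/-- `ReplM ψ χ φ φ'`: `φ'` is obtained from `φ` by replacing some occurrences of `ψ` by `χ`. -/
inductive ReplM (ψ χ : FormM) : FormM → FormM → Prop
  | base : ReplM ψ χ ψ χ
  | refl (φ : FormM) : ReplM ψ χ φ φ
  | neg {φ φ'} : ReplM ψ χ φ φ' → ReplM ψ χ (.neg φ) (.neg φ')
  | and {φ₁ φ₁' φ₂ φ₂'} : ReplM ψ χ φ₁ φ₁' → ReplM ψ χ φ₂ φ₂' →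
      ReplM ψ χ (.and φ₁ φ₂) (.and φ₁' φ₂')
  | box (i) {φ φ'} : ReplM ψ χ φ φ' → ReplM ψ χ (.box i φ) (.box i φ')
  | boxc (i c) {φ φ'} : ReplM ψ χ φ φ' → ReplM ψ χ (.boxc i c φ) (.boxc i c φ')

/-- `φ` is an instance of a propositional tautology: every Boolean valuation of formulas
respecting ⊤, ¬ and ∧ makes it true. -/
def TautM (φ : FormM) : Prop :=
  ∀ v : FormM → Bool, v .top = true → (∀ ψ, v (.neg ψ) = !v ψ) →
    (∀ ψ χ, v (.and ψ χ) = (v ψ && v χ)) → v φ = true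

/-- The proof system SMLKV^r: TAUT, DISTK, DISTKv^r, Kv^r∨, with rules MP,
necessitation for □_i and □_i^c, uniform substitution, and replacement of equivalents. -/
inductive ProvM : FormM → Prop
  | taut {φ} : TautM φ → ProvM φ
  | distK (i : ℕ) (φ ψ : FormM) :
      ProvM (.imp (.box i (.imp φ ψ)) (.imp (.box i φ) (.box i ψ)))
  | distKv (i c : ℕ) (φ ψ : FormM) :
      ProvM (.imp (.box i (.imp φ ψ)) (.imp (.boxc i c φ) (.boxc i c ψ)))
  | kvOr (i c : ℕ) (φ ψ : FormM) :
      ProvM (.imp (.and (.dia i (.and φ ψ)) (.diac i c (.or φ ψ)))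
        (.or (.diac i c φ) (.diac i c ψ)))
  | mp {φ ψ} : ProvM (.imp φ ψ) → ProvM φ → ProvM ψ
  | necK (i : ℕ) {φ} : ProvM φ → ProvM (.box i φ)
  | necKv (i c : ℕ) {φ} : ProvM φ → ProvM (.boxc i c φ)
  | subst (p : ℕ) (χ : FormM) {φ} : ProvM φ → ProvM (FormM.subst p χ φ)
  | re {ψ χ φ φ'} : ProvM (.iff ψ χ) → ReplM ψ χ φ φ' → ProvM (.iff φ φ')

/-- Conjunction of a finite list of formulas. -/
def conjM (L : List FormM) : FormM := L.foldr FormM.and FormM.top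

/-- `φ` is derivable from `Γ` in SMLKV^r. -/
def ProvFromM (Γ : Set FormM) (φ : FormM) : Prop :=
  ∃ L : List FormM, (∀ ψ ∈ L, ψ ∈ Γ) ∧ ProvM (.imp (conjM L) φ)

/-- `Γ` is SMLKV^r-consistent. -/
def ConsistentM (Γ : Set FormM) : Prop := ¬ ProvFromM Γ .bot

/-- `s` is a maximal SMLKV^r-consistent set. -/
def MCSM (s : Set FormM) : Prop :=
  ConsistentM s ∧ ∀ φ ∉ s, ¬ ConsistentM (insert φ s)

/-- Canonical binary relation: `s →_i t` iff `{φ : □_i φ ∈ s} ⊆ t`. -/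
def canRel (i : ℕ) (s t : Set FormM) : Prop := ∀ φ, FormM.box i φ ∈ s → φ ∈ t

/-- Canonical ternary relation: `s R_i^c t u` iff `{φ : □_i φ ∈ s} ⊆ t ∩ u` and
`{ψ : □_i^c ψ ∈ s} ⊆ t ∪ u`. -/
def canRelc (i c : ℕ) (s t u : Set FormM) : Prop :=
  (∀ φ, FormM.box i φ ∈ s → φ ∈ t ∧ φ ∈ u) ∧
  (∀ ψ, FormM.boxc i c ψ ∈ s → ψ ∈ t ∨ ψ ∈ u)

/-- Semantic entailment over MLKv^r models. -/
def EntailsM (Γ : Set FormM) (φ : FormM) : Prop :=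
  ∀ M : KFrame, M.IsMLKv → ∀ s : M.S, (∀ ψ ∈ Γ, satM M s ψ) → satM M s φ

/-- Boolean valuations of formulas that respect `⊤`, `¬` and `∧`. -/
structure IsBoolVal (v : FormM → Bool) : Prop where
  top : v .top = true
  neg : ∀ ψ, v (.neg ψ) = !v ψ
  and : ∀ ψ χ, v (.and ψ χ) = (v ψ && v χ)

namespace IsBoolVal

theorem bot {v : FormM → Bool} (hv : IsBoolVal v) : v .bot = false := by
  simp [FormM.bot, hv.neg, hv.top]

theorem imp {v : FormM → Bool} (hv : IsBoolVal v) (φ ψ : FormM) :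
    v (.imp φ ψ) = true ↔ (v φ = true → v ψ = true) := by
  simp only [FormM.imp, hv.neg, hv.and]
  cases v φ <;> cases v ψ <;> simp

theorem or {v : FormM → Bool} (hv : IsBoolVal v) (φ ψ : FormM) :
    v (.or φ ψ) = (v φ || v ψ) := by
  simp [FormM.or, hv.neg, hv.and]

theorem conjM {v : FormM → Bool} (hv : IsBoolVal v) (L : List FormM) :
    v (conjM L) = true ↔ ∀ ψ ∈ L, v ψ = true := by
  induction L with
  | nil => simpa [_root_.conjM] using hv.top
  | cons ψ L ih =>
    have h := hv.and ψ (_root_.conjM L)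
    simp only [_root_.conjM, List.foldr_cons] at h ih ⊢
    simp [h, ih]

end IsBoolVal

theorem ProvM.of_boolVal {φ : FormM} (h : ∀ v, IsBoolVal v → v φ = true) : ProvM φ :=
  .taut fun v h₁ h₂ h₃ => h v ⟨h₁, h₂, h₃⟩

/-- Provability is closed under Boolean consequence. -/
theorem ProvM.boolConseq {φ ψ : FormM} (hφ : ProvM φ)
    (h : ∀ v, IsBoolVal v → v φ = true → v ψ = true) : ProvM ψ :=
  .mp (.of_boolVal fun v hv => (hv.imp _ _).2 (h v hv)) hφ

theorem ProvM.boolConseq₂ {φ ψ χ : FormM} (hφ : ProvM φ) (hψ : ProvM ψ)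
    (h : ∀ v, IsBoolVal v → v φ = true → v ψ = true → v χ = true) : ProvM χ :=
  .mp (hφ.boolConseq (ψ := .imp ψ χ) fun v hv h₁ => (hv.imp _ _).2 (h v hv h₁)) hψ

namespace ProvFromM

theorem of_provM (Γ : Set FormM) {φ : FormM} (h : ProvM φ) : ProvFromM Γ φ :=
  ⟨[], by simp, h.boolConseq fun _ hv h => (hv.imp _ _).2 fun _ => h⟩

theorem of_mem {Γ : Set FormM} {φ : FormM} (h : φ ∈ Γ) : ProvFromM Γ φ :=
  ⟨[φ], by simpa, .of_boolVal fun _ hv => (hv.imp _ _).2 fun h =>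
    (hv.conjM _).1 h φ (by simp)⟩

theorem mp {Γ : Set FormM} {φ ψ : FormM} (h₁ : ProvFromM Γ (.imp φ ψ)) (h₂ : ProvFromM Γ φ) :
    ProvFromM Γ ψ := by
  obtain ⟨L₁, hL₁, h₁⟩ := h₁
  obtain ⟨L₂, hL₂, h₂⟩ := h₂
  refine ⟨L₁ ++ L₂, fun χ hχ => (List.mem_append.1 hχ).elim (hL₁ χ) (hL₂ χ),
    h₁.boolConseq₂ h₂ fun v hv => ?_⟩
  simp only [hv.imp, hv.conjM, List.mem_append]
  exact fun a b c => a (fun x hx => c x (.inl hx)) (b fun x hx => c x (.inr hx))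

theorem deduction {Γ : Set FormM} {φ ψ : FormM} (h : ProvFromM (insert φ Γ) ψ) :
    ProvFromM Γ (.imp φ ψ) := by
  classical
  obtain ⟨L, hL, h⟩ := h
  refine ⟨L.filter (· ≠ φ), fun χ hχ => ?_, h.boolConseq fun v hv => ?_⟩
  · simp only [List.mem_filter, decide_eq_true_eq] at hχ
    exact (hL χ hχ.1).resolve_left hχ.2
  · simp only [hv.imp, hv.conjM, List.mem_filter, decide_eq_true_eq]
    intro a b c
    refine a fun x hx => ?_
    by_cases hxφ : x = φ
    · rwa [hxφ]
    · exact b x ⟨hx, hxφ⟩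

theorem by_contra {Γ : Set FormM} {φ : FormM} (h : ProvFromM (insert (.neg φ) Γ) .bot) :
    ProvFromM Γ φ :=
  mp (of_provM Γ (.of_boolVal fun v hv => by simp [hv.imp, hv.neg, hv.bot])) h.deduction

/-- A set of formulas containing `Γ` and closed under conjunctions and provable implications
contains everything derivable from `Γ`. -/
theorem mem_of_closed {Γ G : Set FormM} (hΓ : Γ ⊆ G) (top : FormM.top ∈ G)
    (and : ∀ φ ∈ G, ∀ ψ ∈ G, FormM.and φ ψ ∈ G)
    (imp : ∀ φ ψ, ProvM (.imp φ ψ) → φ ∈ G → ψ ∈ G) {φ : FormM} (h : ProvFromM Γ φ) : φ ∈ G := by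
  obtain ⟨L, hL, h⟩ := h
  refine imp _ _ h ?_
  clear h
  induction L with
  | nil => exact top
  | cons ψ L ih =>
    exact and _ (hΓ (hL ψ (by simp))) _ (ih fun χ hχ => hL χ (by simp [hχ]))

end ProvFromM

/-- Lindenbaum's lemma. -/
theorem ConsistentM.exists_MCSM {Γ : Set FormM} (h : ConsistentM Γ) : ∃ s, Γ ⊆ s ∧ MCSM s := by
  obtain ⟨s, hs, hmax⟩ := zorn_subset_nonempty {s | ConsistentM s} (fun c hc hchain hne => by
    refine ⟨⋃₀ c, ?_, fun s hs => Set.subset_sUnion_of_mem hs⟩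
    rintro ⟨L, hL, hbot⟩
    obtain ⟨t, ht, hsub⟩ := hchain.directedOn.exists_mem_subset_of_finite_of_subset_sUnion
      hne L.finite_toSet hL
    exact hc ht ⟨L, hsub, hbot⟩) Γ h
  refine ⟨s, hs, hmax.prop, fun φ hφ hcon => hφ ?_⟩
  exact hmax.le_of_ge hcon (Set.subset_insert φ s) (Set.mem_insert φ s)

namespace MCSM

theorem mem_of_provFromM {s : Set FormM} (hs : MCSM s) {φ : FormM} (h : ProvFromM s φ) :
    φ ∈ s := by
  by_contra hφ
  exact hs.1 ((not_not.1 (hs.2 φ hφ)).deduction.mp h)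

theorem mem_of_provM {s : Set FormM} (hs : MCSM s) {φ : FormM} (h : ProvM φ) : φ ∈ s :=
  hs.mem_of_provFromM (.of_provM s h)

theorem top_mem {s : Set FormM} (hs : MCSM s) : FormM.top ∈ s :=
  hs.mem_of_provM (.of_boolVal fun _ hv => hv.top)

theorem mp {s : Set FormM} (hs : MCSM s) {φ ψ : FormM} (h : FormM.imp φ ψ ∈ s) (hφ : φ ∈ s) :
    ψ ∈ s :=
  hs.mem_of_provFromM ((ProvFromM.of_mem h).mp (.of_mem hφ))

theorem neg_mem {s : Set FormM} (hs : MCSM s) (φ : FormM) : FormM.neg φ ∈ s ↔ φ ∉ s := by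
  refine ⟨fun h hφ => hs.1 ?_, fun h => hs.mem_of_provFromM ?_⟩
  · refine ((ProvFromM.of_provM s ?_).mp (.of_mem h)).mp (.of_mem hφ)
    exact .of_boolVal fun v hv => by simp [hv.imp, hv.neg, hv.bot]
  · refine (ProvFromM.of_provM s ?_).mp (not_not.1 (hs.2 φ h)).deduction
    exact .of_boolVal fun v hv => by simp [hv.imp, hv.neg, hv.bot]

theorem and_mem {s : Set FormM} (hs : MCSM s) (φ ψ : FormM) :
    FormM.and φ ψ ∈ s ↔ φ ∈ s ∧ ψ ∈ s := by
  refine ⟨fun h => ⟨hs.mp (hs.mem_of_provM ?_) h, hs.mp (hs.mem_of_provM ?_) h⟩,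
    fun h => hs.mp (hs.mp (hs.mem_of_provM ?_) h.1) h.2⟩ <;>
  exact .of_boolVal fun v hv => by simp +contextual [hv.imp, hv.and]

theorem or_mem {s : Set FormM} (hs : MCSM s) (φ ψ : FormM) :
    FormM.or φ ψ ∈ s ↔ φ ∈ s ∨ ψ ∈ s := by
  simp only [FormM.or, hs.neg_mem, hs.and_mem]
  tauto

theorem box_mono {s : Set FormM} (hs : MCSM s) (i : ℕ) {φ ψ : FormM} (h : ProvM (.imp φ ψ))
    (hφ : FormM.box i φ ∈ s) : FormM.box i ψ ∈ s :=
  hs.mp (hs.mp (hs.mem_of_provM (.distK i φ ψ)) (hs.mem_of_provM (.necK i h))) hφ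

theorem boxc_mono {s : Set FormM} (hs : MCSM s) (i c : ℕ) {φ ψ : FormM}
    (h : FormM.box i (.imp φ ψ) ∈ s) (hφ : FormM.boxc i c φ ∈ s) : FormM.boxc i c ψ ∈ s :=
  hs.mp (hs.mp (hs.mem_of_provM (.distKv i c φ ψ)) h) hφ

theorem boxc_mono_of_provM {s : Set FormM} (hs : MCSM s) (i c : ℕ) {φ ψ : FormM}
    (h : ProvM (.imp φ ψ)) (hφ : FormM.boxc i c φ ∈ s) : FormM.boxc i c ψ ∈ s :=
  hs.boxc_mono i c (hs.mem_of_provM (.necK i h)) hφ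

theorem box_and {s : Set FormM} (hs : MCSM s) {i : ℕ} {φ ψ : FormM}
    (hφ : FormM.box i φ ∈ s) (hψ : FormM.box i ψ ∈ s) : FormM.box i (.and φ ψ) ∈ s := by
  refine hs.mp (hs.mp (hs.mem_of_provM (.distK i ψ _)) (hs.box_mono i ?_ hφ)) hψ
  exact .of_boolVal fun v hv => by simp +contextual [hv.imp, hv.and]

theorem box_of_provFromM {s : Set FormM} (hs : MCSM s) {i : ℕ} {φ : FormM}
    (h : ProvFromM {ψ | FormM.box i ψ ∈ s} φ) : FormM.box i φ ∈ s :=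
  h.mem_of_closed (G := {ψ | FormM.box i ψ ∈ s}) subset_rfl
    (hs.mem_of_provM (.necK i (.of_boolVal fun _ hv => hv.top)))
    (fun _ h₁ _ h₂ => hs.box_and h₁ h₂) (fun _ _ h => hs.box_mono i h)

theorem exists_of_box_notMem {s : Set FormM} (hs : MCSM s) {i : ℕ} {φ : FormM}
    (h : FormM.box i φ ∉ s) : ∃ t, MCSM t ∧ canRel i s t ∧ φ ∉ t := by
  have hcon : ConsistentM (insert (.neg φ) {ψ | FormM.box i ψ ∈ s}) :=
    fun hbot => h (hs.box_of_provFromM hbot.by_contra)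
  obtain ⟨t, hsub, ht⟩ := hcon.exists_MCSM
  exact ⟨t, ht, fun ψ hψ => hsub (.inr hψ), (ht.neg_mem φ).1 (hsub (.inl rfl))⟩

/-- Semantically: a successor falsifying `φ` and `ψ` makes `□_i^c φ` and `□_i^c ψ` yield
`□_i^c (φ ∧ ψ)`. -/
theorem boxc_and {s t : Set FormM} (hs : MCSM s) (ht : MCSM t) {i c : ℕ} (hst : canRel i s t)
    {φ ψ : FormM} (hφ : FormM.boxc i c φ ∈ s) (hψ : FormM.boxc i c ψ ∈ s)
    (hφt : φ ∉ t) (hψt : ψ ∉ t) : FormM.boxc i c (.and φ ψ) ∈ s := by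
  by_contra hcon
  have hdia : FormM.dia i (.and (.neg φ) (.neg ψ)) ∈ s := by
    rw [FormM.dia, hs.neg_mem]
    intro h
    have := hst _ h
    simp only [ht.neg_mem, ht.and_mem] at this
    tauto
  have hdiac : FormM.diac i c (.or (.neg φ) (.neg ψ)) ∈ s := by
    rw [FormM.diac, hs.neg_mem]
    refine fun h => hcon (hs.boxc_mono_of_provM i c ?_ h)
    exact .of_boolVal fun v hv => by simp [hv.imp, hv.and, hv.neg, hv.or]
  have hor := hs.mp (hs.mem_of_provM (.kvOr i c _ _)) ((hs.and_mem _ _).2 ⟨hdia, hdiac⟩)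
  simp only [hs.or_mem, FormM.diac, hs.neg_mem] at hor
  have hnn : ∀ χ : FormM, ProvM (.imp χ (.neg (.neg χ))) := fun χ =>
    .of_boolVal fun v hv => by simp [hv.imp, hv.neg]
  exact hor.elim (fun h => h (hs.boxc_mono_of_provM i c (hnn φ) hφ))
    (fun h => h (hs.boxc_mono_of_provM i c (hnn ψ) hψ))

theorem boxc_of_provFromM {s t : Set FormM} (hs : MCSM s) (ht : MCSM t) {i c : ℕ}
    (hst : canRel i s t) {φ : FormM}
    (h : ProvFromM ({ψ | FormM.box i ψ ∈ s} ∪ {ψ | FormM.boxc i c ψ ∈ s ∧ ψ ∉ t}) φ) :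
    FormM.boxc i c φ ∈ s := by
  have htop : FormM.boxc i c .top ∈ s :=
    hs.mem_of_provM (.necKv i c (.of_boolVal fun _ hv => hv.top))
  let G : Set FormM := {χ | ∃ ψ, FormM.boxc i c ψ ∈ s ∧ (ψ = .top ∨ ψ ∉ t) ∧
    FormM.box i (.imp ψ χ) ∈ s}
  have hself (ψ : FormM) : FormM.box i (.imp ψ ψ) ∈ s :=
    hs.mem_of_provM (.necK i (.of_boolVal fun v hv => (hv.imp _ _).2 id))
  suffices φ ∈ G by
    obtain ⟨ψ, hψ, -, hψφ⟩ := this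
    exact hs.boxc_mono i c hψφ hψ
  refine h.mem_of_closed (G := G) ?_ ⟨.top, htop, .inl rfl, hself _⟩ ?_ ?_
  · rintro χ (hχ | ⟨hχ, hχt⟩)
    · refine ⟨.top, htop, .inl rfl, hs.box_mono i ?_ hχ⟩
      exact .of_boolVal fun v hv => by simp +contextual [hv.imp]
    · exact ⟨χ, hχ, .inr hχt, hself _⟩
  · rintro χ₁ ⟨ψ₁, h₁, h₁t, h₁χ⟩ χ₂ ⟨ψ₂, h₂, h₂t, h₂χ⟩
    have hand := hs.box_and h₁χ h₂χ
    rcases h₁t with rfl | h₁t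
    · refine ⟨ψ₂, h₂, h₂t, hs.box_mono i ?_ hand⟩
      exact .of_boolVal fun v hv => by simp +contextual [hv.imp, hv.and, hv.top]
    rcases h₂t with rfl | h₂t
    · refine ⟨ψ₁, h₁, .inr h₁t, hs.box_mono i ?_ hand⟩
      exact .of_boolVal fun v hv => by simp +contextual [hv.imp, hv.and, hv.top]
    · refine ⟨.and ψ₁ ψ₂, hs.boxc_and ht hst h₁ h₂ h₁t h₂t,
        .inr fun h => h₁t ((ht.and_mem _ _).1 h).1, hs.box_mono i ?_ hand⟩
      exact .of_boolVal fun v hv => by simp +contextual [hv.imp, hv.and]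
  · rintro χ₁ χ₂ hχ ⟨ψ, h₁, h₂, h₃⟩
    refine ⟨ψ, h₁, h₂, hs.box_mono i (hχ.boolConseq fun v hv => ?_) h₃⟩
    simp only [hv.imp]
    tauto

theorem exists_of_boxc_notMem {s : Set FormM} (hs : MCSM s) {i c : ℕ} {φ : FormM}
    (h : FormM.boxc i c φ ∉ s) :
    ∃ t u, MCSM t ∧ MCSM u ∧ canRelc i c s t u ∧ φ ∉ t ∧ φ ∉ u := by
  have hbox : FormM.box i φ ∉ s := fun hφ => by
    refine h (hs.boxc_mono i c (hs.box_mono i ?_ hφ)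
      (hs.mem_of_provM (.necKv i c (φ := .top) (.of_boolVal fun _ hv => hv.top))))
    exact .of_boolVal fun v hv => by simp +contextual [hv.imp]
  obtain ⟨t, ht, hst, hφt⟩ := hs.exists_of_box_notMem hbox
  have hcon : ConsistentM (insert (.neg φ)
      ({ψ | FormM.box i ψ ∈ s} ∪ {ψ | FormM.boxc i c ψ ∈ s ∧ ψ ∉ t})) :=
    fun hbot => h (hs.boxc_of_provFromM ht hst hbot.by_contra)
  obtain ⟨u, hsub, hu⟩ := hcon.exists_MCSM
  refine ⟨t, u, ht, hu, ⟨fun ψ hψ => ⟨hst ψ hψ, hsub (.inr (.inl hψ))⟩, fun ψ hψ => ?_⟩, hφt,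
    (hu.neg_mem φ).1 (hsub (.inl rfl))⟩
  by_cases hψt : ψ ∈ t
  · exact .inl hψt
  · exact .inr (hsub (.inr (.inr ⟨hψ, hψt⟩)))

end MCSM

/-- The canonical model, whose worlds are the maximal consistent sets. -/
def canonicalFrame : KFrame where
  S := {s : Set FormM // MCSM s}
  rel i s t := canRel i s.1 t.1
  relc i c s t u := canRelc i c s.1 t.1 u.1
  val s p := FormM.atom p ∈ s.1

theorem canonicalFrame_isMLKv : canonicalFrame.IsMLKv := by
  refine ⟨fun i c s t u => ?_, fun i c s t u h => ⟨fun φ hφ => (h.1 φ hφ).1,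
    fun φ hφ => (h.1 φ hφ).2⟩, ?_⟩
  · simp only [canonicalFrame, canRelc, and_comm, or_comm]
  · rintro i c ⟨s, hs⟩ ⟨t, ht⟩ ⟨u, hu⟩ ⟨v, hv⟩ ⟨hbox, hboxc⟩ hsv
    by_contra! hcon
    have key (w : Set FormM) (hw : ∀ φ, FormM.box i φ ∈ s → φ ∈ w) (h : ¬ canRelc i c s w v) :
        ∃ ψ, FormM.boxc i c ψ ∈ s ∧ ψ ∉ w ∧ ψ ∉ v := by
      by_contra! h'
      exact h ⟨fun φ hφ => ⟨hw φ hφ, hsv φ hφ⟩, fun ψ hψ => or_iff_not_imp_left.2 (h' ψ hψ)⟩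
    obtain ⟨ψ, hψ, hψt, hψv⟩ := key t (fun φ hφ => (hbox φ hφ).1) hcon.1
    obtain ⟨χ, hχ, hχu, hχv⟩ := key u (fun φ hφ => (hbox φ hφ).2) hcon.2
    exact (hboxc _ (hs.boxc_and hv hsv hψ hχ hψv hχv)).elim
      (fun h => hψt ((ht.and_mem _ _).1 h).1) (fun h => hχu ((hu.and_mem _ _).1 h).2)

theorem satM_canonicalFrame (φ : FormM) (s : canonicalFrame.S) :
    satM canonicalFrame s φ ↔ φ ∈ s.1 := by
  induction φ generalizing s with
  | top => exact iff_of_true trivial s.2.top_mem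
  | atom p => rfl
  | neg φ ih => rw [satM, ih, s.2.neg_mem]
  | and φ ψ ih₁ ih₂ => rw [satM, ih₁, ih₂, s.2.and_mem]
  | box i φ ih =>
    simp only [satM, ih]
    refine ⟨fun h => ?_, fun h t hst => hst φ h⟩
    by_contra hφ
    obtain ⟨t, ht, hst, hφt⟩ := s.2.exists_of_box_notMem hφ
    exact hφt (h ⟨t, ht⟩ hst)
  | boxc i c φ ih =>
    simp only [satM, ih]
    refine ⟨fun h => ?_, fun h t u hstu => hstu.2 φ h⟩
    by_contra hφ
    obtain ⟨t, u, ht, hu, hstu, hφt, hφu⟩ := s.2.exists_of_boxc_notMem hφ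
    exact (h ⟨t, ht⟩ ⟨u, hu⟩ hstu).elim hφt hφu

theorem ConsistentM.satisfiable {Γ : Set FormM} (h : ConsistentM Γ) :
    ∃ M : KFrame, M.IsMLKv ∧ ∃ s : M.S, ∀ φ ∈ Γ, satM M s φ := by
  obtain ⟨s, hΓ, hs⟩ := h.exists_MCSM
  exact ⟨canonicalFrame, canonicalFrame_isMLKv, ⟨s, hs⟩,
    fun φ hφ => (satM_canonicalFrame φ _).2 (hΓ hφ)⟩

/-- SMLKV^r is strongly complete w.r.t. the class of all MLKv^r models:
every consistent set is satisfiable in an MLKv^r model; equivalently, semantic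
entailment implies derivability. -/
theorem stmt8 :
    (∀ Γ : Set FormM, ConsistentM Γ →
      ∃ M : KFrame, M.IsMLKv ∧ ∃ s : M.S, ∀ φ ∈ Γ, satM M s φ) ∧
    (∀ (Γ : Set FormM) (φ : FormM), EntailsM Γ φ → ProvFromM Γ φ) := by
  refine ⟨fun Γ h => h.satisfiable, fun Γ φ h => ProvFromM.by_contra ?_⟩
  by_contra hcon
  obtain ⟨M, hM, s, hs⟩ := ConsistentM.satisfiable hcon
  exact hs _ (.inl rfl) (h M hM s fun ψ hψ => hs ψ (.inr hψ))
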